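/- Let K, t be integers with t ≥ 1 and K ≥ t + 2. Let S = {i, i+1, ..., i+t−1} be a cyclic interval of length t in ZMod K, and let A ⊆ ZMod K be a set with |A| < t that is disjoint from S ∪ {i−1, i+t}. Then the only cyclic interval of length t contained in S ∪ A is S itself. (This shows that in the regime 1 + γ_p < t, every choice of 1 + γ_p elements outside S ∪ {i−1, i+t} yields a transmission-subset containing exactly one subfile-index set, namely S.) -/

import Mathlib

/-- The cyclic interval `{i, i+1, ..., i+m−1}` (addition modulo `K`) in `ZMod K`. -/
def cycInterval (K m : ℕ) (i : ZMod K) : Finset (ZMod K) :=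
  (Finset.range m).image (fun j : ℕ => (i + (j : ZMod K)))

/-- `S` is a cyclic interval of length `m` in `ZMod K`. -/
def IsCycInterval (K m : ℕ) (S : Finset (ZMod K)) : Prop :=
  ∃ i : ZMod K, S = cycInterval K m i

/-- Binomial coefficient on integers with the convention `C(n,k) = 0` whenever
`n < 0`, `k < 0`, or `n < k`. -/
def binomZ (n k : ℤ) : ℤ :=
  if 0 ≤ n ∧ 0 ≤ k ∧ k ≤ n then n.toNat.choose k.toNat else 0

theorem card_cycInterval {K m : ℕ} (hm : m ≤ K) (i : ZMod K) :
    (cycInterval K m i).card = m := by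
  rw [cycInterval, Finset.card_image_of_injOn, Finset.card_range]
  intro x hx y hy hxy
  have hx' : x < m := by simpa using hx
  have hy' : y < m := by simpa using hy
  have h : (x : ZMod K) = y := add_left_cancel hxy
  rw [ZMod.natCast_eq_natCast_iff] at h
  exact h.eq_of_lt_of_lt (hx'.trans_le hm) (hy'.trans_le hm)

theorem add_one_mem_cycInterval {K m : ℕ} {i x : ZMod K} (hx : x ∈ cycInterval K m i)
    (hne : x + 1 ≠ i + (m : ZMod K)) : x + 1 ∈ cycInterval K m i := by
  simp only [cycInterval, Finset.mem_image, Finset.mem_range] at hx ⊢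
  obtain ⟨k, hk, rfl⟩ := hx
  refine ⟨k + 1, lt_of_le_of_ne hk ?_, by push_cast; ring⟩
  rintro rfl
  exact hne (by push_cast; ring)

theorem mem_cycInterval_of_add_one_mem {K m : ℕ} {i x : ZMod K}
    (hx : x + 1 ∈ cycInterval K m i) (hne : x ≠ i - 1) : x ∈ cycInterval K m i := by
  simp only [cycInterval, Finset.mem_image, Finset.mem_range] at hx ⊢
  obtain ⟨k, hk, hkx⟩ := hx
  cases k with
  | zero => exact absurd (eq_sub_of_add_eq (by simpa using hkx.symm)) hne
  | succ k =>
    refine ⟨k, by omega, add_right_cancel (b := 1) ?_⟩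
    rw [← hkx]
    push_cast
    ring

/-- **Uniqueness of the subfile-index set in Special Case 1.**
Let `t ≥ 1`, `K ≥ t + 2`, let `S = {i, ..., i+t−1}` be a cyclic interval of length `t` in
`ZMod K`, and let `A ⊆ ZMod K` with `|A| < t` be disjoint from `S ∪ {i−1, i+t}`. Then the
only cyclic interval of length `t` contained in `S ∪ A` is `S` itself. -/
theorem cycInterval_unique_of_avoid_neighbors
    (K t : ℕ) (ht : 1 ≤ t) (hK : t + 2 ≤ K) (i : ZMod K)
    (A : Finset (ZMod K)) (hA : A.card < t)
    (hdisj : Disjoint A (cycInterval K t i ∪ {i - 1, i + (t : ZMod K)})) :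
    ∀ S : Finset (ZMod K), S ⊆ cycInterval K t i ∪ A → IsCycInterval K t S →
      S = cycInterval K t i := by
  rintro S hS ⟨a, rfl⟩
  have avoid : ∀ x ∈ A, x ≠ i - 1 ∧ x ≠ i + (t : ZMod K) := by
    intro x hx
    have h := Finset.disjoint_left.mp hdisj hx
    constructor <;> rintro rfl <;> simp at h
  have mem_a : ∀ j < t, a + (j : ZMod K) ∈ cycInterval K t a := fun j hj =>
    Finset.mem_image_of_mem _ (Finset.mem_range.mpr hj)
  have mem_iff : ∀ j < t, (a + (j : ZMod K) ∈ cycInterval K t i ↔ a ∈ cycInterval K t i) := by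
    intro j
    induction j with
    | zero => simp
    | succ j ih =>
      intro hj
      rw [← ih (by omega)]
      have hcast : a + ((j + 1 : ℕ) : ZMod K) = a + (j : ZMod K) + 1 := by push_cast; ring
      have h₀ := Finset.mem_union.mp (hS (mem_a j (by omega)))
      have h₁ := Finset.mem_union.mp (hS (mem_a (j + 1) hj))
      rw [hcast] at h₁ ⊢
      constructor
      · exact fun h => h₀.elim id fun hA₀ =>
          mem_cycInterval_of_add_one_mem h (avoid _ hA₀).1
      · exact fun h => h₁.elim id fun hA₁ =>
          add_one_mem_cycInterval h (avoid _ hA₁).2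
  have htK : t ≤ K := by omega
  by_cases ha : a ∈ cycInterval K t i
  · refine Finset.eq_of_subset_of_card_le ?_ (by simp only [card_cycInterval htK, le_refl])
    intro x hx
    obtain ⟨j, hj, rfl⟩ := Finset.mem_image.mp hx
    exact (mem_iff j (Finset.mem_range.mp hj)).mpr ha
  · have hsub : cycInterval K t a ⊆ A := by
      intro x hx
      refine (Finset.mem_union.mp (hS hx)).resolve_left fun hxi => ha ?_
      obtain ⟨j, hj, rfl⟩ := Finset.mem_image.mp hx
      exact (mem_iff j (Finset.mem_range.mp hj)).mp hxi
    have hcard := Finset.card_le_card hsub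
    rw [card_cycInterval htK] at hcard
    omega
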